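/- There exist absolute constants C₁, C₂ > 0 such that for all independent zero-mean real random variables X, Y satisfying E[e^{λX}] ≤ e^{λ²σ_X²} for all real λ and E[e^{λY}] ≤ e^{λ²σ_Y²} for all real λ, one has E[e^{λXY}] ≤ e^{λ²(C₁ σ_X σ_Y)²} for all λ with |λ| ≤ C₂/(σ_X σ_Y). -/

import Mathlib

open MeasureTheory ProbabilityTheory Real

open scoped ENNReal

open Filter

variable {α β : Type*} [MeasurableSpace α] [MeasurableSpace β]

/-- `X` has Bochner mean zero and Bochner moment generating function at most `exp (t ^ 2)`.
Neither `X` nor its exponentials are required to be integrable. -/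
structure FormallySubGaussian (X : α → ℝ) (p : Measure α) : Prop where
  measurable : Measurable X
  integral_eq_zero : ∫ a, X a ∂p = 0
  integral_exp_le : ∀ t : ℝ, ∫ a, exp (t * X a) ∂p ≤ exp (t ^ 2)

/-- The remainder of order two of the exponential. -/
noncomputable def expRemainder (u : ℝ) : ℝ := exp u - 1 - u

lemma measurable_expRemainder : Measurable expRemainder := by
  unfold expRemainder; fun_prop

lemma expRemainder_nonneg (u : ℝ) : 0 ≤ expRemainder u := by
  have := add_one_le_exp u
  unfold expRemainder; linarith

lemma expRemainder_zero : expRemainder 0 = 0 := by simp [expRemainder]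

lemma expRemainder_le_of_nonpos {u : ℝ} (hu : u ≤ 0) : expRemainder u ≤ u ^ 2 / 2 := by
  have h := quadratic_le_exp_of_nonneg (neg_nonneg.2 hu)
  have hpos : 0 < 1 + -u + (-u) ^ 2 / 2 := by nlinarith [sq_nonneg u]
  have h2 : exp u * exp (-u) = 1 := by rw [← exp_add]; simp
  have h3 : exp u * (1 + -u + (-u) ^ 2 / 2) ≤ 1 := by
    exact (mul_le_mul_of_nonneg_left h (exp_pos u).le).trans_eq h2
  have h4 : 1 ≤ (1 + u + u ^ 2 / 2) * (1 + -u + (-u) ^ 2 / 2) := by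
    have : (1 + u + u ^ 2 / 2) * (1 + -u + (-u) ^ 2 / 2) = 1 + (u ^ 2) ^ 2 / 4 := by ring
    rw [this]; nlinarith [sq_nonneg (u ^ 2)]
  have h5 : exp u ≤ 1 + u + u ^ 2 / 2 := le_of_mul_le_mul_right (h3.trans h4) hpos
  unfold expRemainder; linarith

lemma sq_le_four_mul_expRemainder {u : ℝ} (hu : |u| ≤ 1) : u ^ 2 ≤ 4 * expRemainder u := by
  have h := Real.exp_bound hu (n := 3) (by norm_num)
  norm_num [Finset.sum_range_succ, Nat.factorial] at h
  have h1 := (abs_le.1 h).1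
  have h2 : |u| ^ 3 ≤ u ^ 2 := by
    rw [← sq_abs u]
    nlinarith [sq_nonneg |u|]
  unfold expRemainder; linarith [sq_nonneg u]

lemma expRemainder_mul_le (s x y : ℝ) (hs : 0 < s) :
    expRemainder (s * (x * y)) ≤ expRemainder (s * (max x 0 * max y 0))
      + expRemainder (s * (max (-x) 0 * max (-y) 0)) + s ^ 2 / 2 * (x ^ 2 * y ^ 2) := by
  have h1 := expRemainder_nonneg (s * (max x 0 * max y 0))
  have h2 := expRemainder_nonneg (s * (max (-x) 0 * max (-y) 0))
  have h3 : 0 ≤ s ^ 2 / 2 * (x ^ 2 * y ^ 2) := by positivity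
  have key (h : x * y ≤ 0) : expRemainder (s * (x * y)) ≤ s ^ 2 / 2 * (x ^ 2 * y ^ 2) :=
    (expRemainder_le_of_nonpos (mul_nonpos_of_nonneg_of_nonpos hs.le h)).trans_eq (by ring)
  rcases le_total 0 x with hx | hx <;> rcases le_total 0 y with hy | hy
  · rw [max_eq_left hx, max_eq_left hy] at *; linarith
  · linarith [key (mul_nonpos_of_nonneg_of_nonpos hx hy)]
  · linarith [key (mul_nonpos_of_nonpos_of_nonneg hx hy)]
  · have e : max (-x) 0 * max (-y) 0 = x * y := by
      rw [max_eq_left (neg_nonneg.2 hx), max_eq_left (neg_nonneg.2 hy)]; ring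
    rw [e] at *; linarith

lemma exp_mul_sub_one_le {r w : ℝ} (h0 : 0 ≤ r) (h1 : r ≤ 1) :
    exp (r * w) - 1 ≤ r * exp w := by
  have h := convexOn_exp.2 (Set.mem_univ w) (Set.mem_univ 0) h0 (sub_nonneg.2 h1) (by ring)
  simp only [smul_eq_mul, mul_zero, add_zero, exp_zero, mul_one] at h
  linarith

lemma integrable_exp_mul_of_le {X : α → ℝ} {p : Measure α} [IsProbabilityMeasure p]
    (hX : Measurable X) {t u : ℝ} (ht : 0 ≤ t) (htu : t ≤ u)
    (hu : Integrable (fun a => exp (u * X a)) p) : Integrable (fun a => exp (t * X a)) p := by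
  refine ((integrable_const 1).add hu).mono' (by fun_prop) (ae_of_all _ fun a => ?_)
  rw [norm_of_nonneg (exp_pos _).le]
  change _ ≤ 1 + exp (u * X a)
  rcases le_total 0 (X a) with h | h
  · have : exp (t * X a) ≤ exp (u * X a) := exp_le_exp.2 (mul_le_mul_of_nonneg_right htu h)
    linarith
  · have : exp (t * X a) ≤ 1 := exp_le_one_iff.2 (mul_nonpos_of_nonneg_of_nonpos ht h)
    linarith [exp_pos (u * X a)]

lemma integrable_exp_mul_of_ae_le {X : α → ℝ} {p : Measure α} [IsProbabilityMeasure p]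
    (hX : Measurable X) {t M : ℝ} (h : ∀ᵐ a ∂p, t * X a ≤ M) :
    Integrable (fun a => exp (t * X a)) p := by
  refine (integrable_const (exp M)).mono' (by fun_prop) (h.mono fun a ha => ?_)
  rw [norm_of_nonneg (exp_pos _).le]
  exact exp_le_exp.2 ha

lemma integrable_of_integrable_exp_mul {X : α → ℝ} {p : Measure α}
    (hX : Measurable X) {t u : ℝ} (ht : 0 < t) (hu : u < 0)
    (hti : Integrable (fun a => exp (t * X a)) p) (hui : Integrable (fun a => exp (u * X a)) p) :
    Integrable X p := by
  refine ((hti.const_mul t⁻¹).add (hui.const_mul (-u)⁻¹)).mono' (by fun_prop)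
    (ae_of_all _ fun a => ?_)
  change |X a| ≤ t⁻¹ * exp (t * X a) + (-u)⁻¹ * exp (u * X a)
  have hu' : 0 < -u := neg_pos.2 hu
  have h1 : X a ≤ t⁻¹ * exp (t * X a) := by
    rw [inv_mul_eq_div, le_div_iff₀ ht]; linarith [add_one_le_exp (t * X a)]
  have h2 : -X a ≤ (-u)⁻¹ * exp (u * X a) := by
    rw [inv_mul_eq_div, le_div_iff₀ hu']; linarith [add_one_le_exp (u * X a)]
  have h3 : 0 < t⁻¹ * exp (t * X a) := by positivity
  have h4 : 0 < (-u)⁻¹ * exp (u * X a) := by positivity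
  exact abs_le.2 ⟨by linarith, by linarith⟩

namespace FormallySubGaussian

variable {X : α → ℝ} {Y : β → ℝ} {p : Measure α} {q : Measure β}

lemma neg (hX : FormallySubGaussian X p) : FormallySubGaussian (fun a => -X a) p where
  measurable := hX.measurable.neg
  integral_eq_zero := by rw [integral_neg, hX.integral_eq_zero, neg_zero]
  integral_exp_le t := by simpa using hX.integral_exp_le (-t)

lemma lintegral_expRemainder_le [IsProbabilityMeasure p]
    (hX : FormallySubGaussian X p) (hi : Integrable X p) {t : ℝ}
    (ht : Integrable (fun a => exp (t * X a)) p) :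
    ∫⁻ a, ENNReal.ofReal (expRemainder (t * X a)) ∂p ≤ ENNReal.ofReal (exp (t ^ 2) - 1) := by
  have h1 : Integrable (fun a => exp (t * X a) - 1) p := ht.sub (integrable_const 1)
  have h2 : Integrable (fun a => t * X a) p := hi.const_mul t
  have h3 : Integrable (fun a => expRemainder (t * X a)) p := h1.sub h2
  rw [← ofReal_integral_eq_lintegral_ofReal h3 (ae_of_all _ fun a => expRemainder_nonneg _)]
  refine ENNReal.ofReal_le_ofReal ?_
  unfold expRemainder
  rw [integral_sub h1 h2, integral_sub ht (integrable_const 1), integral_const_mul,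
    hX.integral_eq_zero]
  simpa using hX.integral_exp_le t

lemma lintegral_sq_le [IsProbabilityMeasure p]
    (hX : FormallySubGaussian X p) (hi : Integrable X p) {t : ℝ} (ht0 : t ≠ 0)
    (ht : Integrable (fun a => exp (t * X a)) p) :
    ∫⁻ a, ENNReal.ofReal (X a ^ 2) ∂p ≤ 8 := by
  set r : ℕ → ℝ := fun n => 1 / ((n : ℝ) + 1) with hr
  have hr0 : ∀ n, 0 < r n := fun n => by positivity
  have hr1 : ∀ n, r n ≤ 1 := fun n => by
    rw [hr]; simp only; rw [div_le_one (by positivity)]; linarith [n.cast_nonneg (α := ℝ)]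
  have hlim : Tendsto r atTop (nhds 0) := tendsto_one_div_add_atTop_nhds_zero_nat
  have hev (c : ℝ) : ∀ᶠ n in atTop, |r n * c| ≤ 1 := by
    have : Tendsto (fun n => |r n * c|) atTop (nhds 0) := by
      simpa using (hlim.mul_const c).abs
    exact this.eventually_le_const one_pos
  have hint (n : ℕ) : Integrable (fun a => exp (r n * t * X a)) p := by
    have h := integrable_exp_mul_of_le (X := fun a => t * X a) (p := p) (u := 1)
      (hX.measurable.const_mul t) (hr0 n).le (hr1 n) (by simpa using ht)
    simpa only [mul_assoc] using h
  let f : ℕ → α → ℝ≥0∞ := fun n a =>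
    ENNReal.ofReal (4 / (r n * t) ^ 2) * ENNReal.ofReal (expRemainder (r n * t * X a))
  have hrt (n : ℕ) : 0 < (r n * t) ^ 2 := by
    have := (hr0 n).ne'
    positivity
  have hm (n : ℕ) : Measurable fun a => ENNReal.ofReal (expRemainder (r n * t * X a)) :=
    (measurable_expRemainder.comp (hX.measurable.const_mul _)).ennreal_ofReal
  calc ∫⁻ a, ENNReal.ofReal (X a ^ 2) ∂p
      ≤ ∫⁻ a, liminf (fun n => f n a) atTop ∂p := by
        refine lintegral_mono fun a => le_liminf_of_le (by isBoundedDefault) ?_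
        filter_upwards [hev (t * X a)] with n hn
        rw [← mul_assoc] at hn
        have := sq_le_four_mul_expRemainder hn
        simp only [f]
        rw [← ENNReal.ofReal_mul (by positivity)]
        refine ENNReal.ofReal_le_ofReal ?_
        rw [div_mul_eq_mul_div, le_div_iff₀ (hrt n)]
        calc X a ^ 2 * (r n * t) ^ 2 = (r n * t * X a) ^ 2 := by ring
          _ ≤ _ := this
    _ ≤ liminf (fun n => ∫⁻ a, f n a ∂p) atTop :=
        lintegral_liminf_le fun n => (hm n).const_mul _
    _ ≤ liminf (fun _ : ℕ => (8 : ℝ≥0∞)) atTop := by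
        refine liminf_le_liminf ?_
        filter_upwards [hev t] with n hn
        simp only [f]
        rw [lintegral_const_mul _ (hm n)]
        refine (mul_le_mul_right (hX.lintegral_expRemainder_le hi (hint n)) _).trans ?_
        rw [← ENNReal.ofReal_mul (by positivity),
          show (8 : ℝ≥0∞) = ENNReal.ofReal 8 by norm_num]
        refine ENNReal.ofReal_le_ofReal ?_
        rw [div_mul_eq_mul_div, div_le_iff₀ (hrt n)]
        have h1 : (r n * t) ^ 2 ≤ 1 := (sq_le_one_iff_abs_le_one _).2 hn
        have h2 := (abs_le.1 (Real.abs_exp_sub_one_le (x := (r n * t) ^ 2)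
          (by rwa [abs_of_pos (hrt n)]))).2
        rw [abs_of_pos (hrt n)] at h2
        linarith
    _ = 8 := liminf_const _

end FormallySubGaussian

/-- A bound for `∫ exp (X⁺ ^ 2 / 16)` for sub-Gaussian `X`. -/
noncomputable def expSqBound : ℝ≥0∞ := ∑' n : ℕ, ENNReal.ofReal (exp (1 - n / 8))

lemma expSqBound_ne_top : expSqBound ≠ ∞ := by
  have h : Summable fun n : ℕ => exp (1 - n / 8) := by
    have := (summable_geometric_of_lt_one (exp_pos (-(1 / 8))).le
      (exp_lt_one_iff.2 (by norm_num : -(1 / 8 : ℝ) < 0))).mul_left (exp 1)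
    refine this.congr fun n => ?_
    rw [← exp_nat_mul, ← exp_add]
    ring_nf
  exact h.tsum_ofReal_ne_top

namespace FormallySubGaussian

variable {X : α → ℝ} {Y : β → ℝ} {p : Measure α} {q : Measure β}

lemma lintegral_exp_sq_posPart_le (hX : FormallySubGaussian X p)
    (h : ∀ t : ℝ, 0 ≤ t → Integrable (fun a => exp (t * X a)) p) :
    ∫⁻ a, ENNReal.ofReal (exp (max (X a) 0 ^ 2 / 16)) ∂p ≤ expSqBound := by
  have hmeas := hX.measurable
  let f : ℕ → α → ℝ := fun n a => exp (((n : ℝ) + 1) ^ 2 / 16 - n ^ 2 / 2) * exp (n / 2 * X a)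
  calc ∫⁻ a, ENNReal.ofReal (exp (max (X a) 0 ^ 2 / 16)) ∂p
      ≤ ∫⁻ a, ∑' n, ENNReal.ofReal (f n a) ∂p := by
        refine lintegral_mono fun a => ?_
        set n := ⌊max (X a) 0⌋₊ with hn
        refine le_trans (ENNReal.ofReal_le_ofReal ?_) (ENNReal.le_tsum n)
        have h0 : 0 ≤ max (X a) 0 := le_max_right _ _
        have h1 : (n : ℝ) ≤ max (X a) 0 := Nat.floor_le h0
        have h2 : max (X a) 0 < n + 1 := Nat.lt_floor_add_one _
        have h3 : 0 ≤ (n : ℝ) * (X a - n) := by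
          rcases le_total 0 (X a) with hx | hx
          · rw [max_eq_left hx] at h1
            exact mul_nonneg n.cast_nonneg (sub_nonneg.2 h1)
          · rw [max_eq_right hx] at h1
            rw [le_antisymm h1 n.cast_nonneg]; simp
        simp only [f]
        rw [← exp_add]
        refine exp_le_exp.2 ?_
        nlinarith
    _ = ∑' n, ∫⁻ a, ENNReal.ofReal (f n a) ∂p :=
        lintegral_tsum fun n => by fun_prop
    _ ≤ expSqBound := by
        refine ENNReal.tsum_le_tsum fun n => ?_
        have hi : Integrable (f n) p := (h (n / 2) (by positivity)).const_mul _
        rw [← ofReal_integral_eq_lintegral_ofReal hi (ae_of_all _ fun a => by positivity)]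
        refine ENNReal.ofReal_le_ofReal ?_
        simp only [f]
        rw [integral_const_mul]
        refine (mul_le_mul_of_nonneg_left (hX.integral_exp_le _) (exp_pos _).le).trans ?_
        rw [← exp_add]
        refine exp_le_exp.2 ?_
        nlinarith [sq_nonneg ((n : ℝ) - 1)]

lemma lintegral_expRemainder_mul_posPart_le [IsProbabilityMeasure p] [IsProbabilityMeasure q]
    (hX : FormallySubGaussian X p)
    (hY : FormallySubGaussian Y q) (hi : Integrable X p) {s : ℝ} (hs : 0 < s) (hs' : s ≤ 1 / 4)
    (h : ∀ᵐ b ∂q, Integrable (fun a => exp (s * Y b * X a)) p)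
    (hg : ∀ t : ℝ, 0 ≤ t → Integrable (fun b => exp (t * Y b)) q) :
    ∫⁻ z, ENNReal.ofReal (expRemainder (s * (max (X z.1) 0 * max (Y z.2) 0))) ∂(p.prod q)
      ≤ ENNReal.ofReal (16 * s ^ 2) * expSqBound := by
  have hmX := hX.measurable
  have hmY := hY.measurable
  have hm : Measurable fun z : α × β =>
      ENNReal.ofReal (expRemainder (s * (max (X z.1) 0 * max (Y z.2) 0))) :=
    (measurable_expRemainder.comp (by fun_prop)).ennreal_ofReal
  rw [lintegral_prod_symm' _ hm]
  calc _ ≤ ∫⁻ b, ENNReal.ofReal (16 * s ^ 2) * ENNReal.ofReal (exp (max (Y b) 0 ^ 2 / 16)) ∂q := by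
        refine lintegral_mono_ae (h.mono fun b hb => ?_)
        set y := max (Y b) 0 with hy
        have hint : Integrable (fun a => exp (s * y * X a)) p := by
          rcases le_total 0 (Y b) with h0 | h0
          · rwa [hy, max_eq_left h0]
          · rw [hy, max_eq_right h0]; simp
        calc ∫⁻ a, ENNReal.ofReal (expRemainder (s * (max (X a) 0 * y))) ∂p
            ≤ ∫⁻ a, ENNReal.ofReal (expRemainder (s * y * X a)) ∂p := by
              refine lintegral_mono fun a => ENNReal.ofReal_le_ofReal ?_
              rcases le_total 0 (X a) with h0 | h0
              · rw [max_eq_left h0]; apply le_of_eq; congr 1; ring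
              · rw [max_eq_right h0]
                simpa [expRemainder_zero] using expRemainder_nonneg _
          _ ≤ ENNReal.ofReal (exp ((s * y) ^ 2) - 1) := hX.lintegral_expRemainder_le hi hint
          _ ≤ ENNReal.ofReal (16 * s ^ 2 * exp (y ^ 2 / 16)) := by
              refine ENNReal.ofReal_le_ofReal ?_
              rw [show (s * y) ^ 2 = 16 * s ^ 2 * (y ^ 2 / 16) by ring]
              exact exp_mul_sub_one_le (by positivity) (by nlinarith)
          _ = _ := ENNReal.ofReal_mul (by positivity)
    _ ≤ _ := by
        rw [lintegral_const_mul _ (by fun_prop)]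
        gcongr
        exact hY.lintegral_exp_sq_posPart_le hg

lemma lintegral_expRemainder_posPart_mul_posPart_le [IsProbabilityMeasure p] [IsProbabilityMeasure q]
    (hX : FormallySubGaussian X p)
    (hY : FormallySubGaussian Y q) (hiX : Integrable X p) (hiY : Integrable Y q)
    {s : ℝ} (hs : 0 < s) (hs' : s ≤ 1 / 4)
    (hp : ∀ᵐ b ∂q, Integrable (fun a => exp (s * Y b * X a)) p)
    (hq : ∀ᵐ a ∂p, Integrable (fun b => exp (s * X a * Y b)) q) :
    ∫⁻ z, ENNReal.ofReal (expRemainder (s * (max (X z.1) 0 * max (Y z.2) 0))) ∂(p.prod q)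
      ≤ ENNReal.ofReal (16 * s ^ 2) * expSqBound := by
  by_cases hg : ∀ t : ℝ, 0 ≤ t → Integrable (fun b => exp (t * Y b)) q
  · exact hX.lintegral_expRemainder_mul_posPart_le hY hiX hs hs' hp hg
  push Not at hg
  obtain ⟨u, hu, hnu⟩ := hg
  have hb : ∀ᵐ a ∂p, X a ≤ u / s := hq.mono fun a ha => by
    by_contra! hlt
    rw [div_lt_iff₀' hs] at hlt
    exact hnu (integrable_exp_mul_of_le hY.measurable hu hlt.le ha)
  have hgX (t : ℝ) (ht : 0 ≤ t) : Integrable (fun a => exp (t * X a)) p :=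
    integrable_exp_mul_of_ae_le hX.measurable (hb.mono fun a ha => mul_le_mul_of_nonneg_left ha ht)
  refine le_trans (le_of_eq ?_)
    (hY.lintegral_expRemainder_mul_posPart_le hX hiY hs hs' hq hgX)
  rw [← lintegral_prod_swap]
  simp only [Prod.fst_swap, Prod.snd_swap, mul_comm]

lemma ae_nonpos_or_ae_nonneg_of_not_integrable [IsProbabilityMeasure p]
    (hX : FormallySubGaussian X p)
    (hi : ¬ Integrable X p) {s : ℝ} (hs : 0 < s)
    (hp : ∀ᵐ b ∂q, Integrable (fun a => exp (s * Y b * X a)) p) :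
    ((∀ᵐ b ∂q, Y b ≤ 0) ∧ ¬ ∀ᵐ a ∂p, X a ≤ 0) ∨ ((∀ᵐ b ∂q, 0 ≤ Y b) ∧ ¬ ∀ᵐ a ∂p, 0 ≤ X a) := by
  by_cases h : ∃ t : ℝ, 0 < t ∧ Integrable (fun a => exp (t * X a)) p
  · obtain ⟨t, ht, hti⟩ := h
    have hn (u : ℝ) (hu : u < 0) : ¬ Integrable (fun a => exp (u * X a)) p := fun hui =>
      hi (integrable_of_integrable_exp_mul hX.measurable ht hu hti hui)
    refine Or.inr ⟨hp.mono fun b hb => ?_, fun hc => hn (-1) (by norm_num) ?_⟩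
    · by_contra! hlt
      exact hn _ (mul_neg_of_pos_of_neg hs hlt) hb
    · exact integrable_exp_mul_of_ae_le hX.measurable (M := 0) (hc.mono fun a ha => by linarith)
  · push Not at h
    refine Or.inl ⟨hp.mono fun b hb => ?_, fun hc => h 1 one_pos ?_⟩
    · by_contra! hlt
      exact h _ (mul_pos hs hlt) hb
    · exact integrable_exp_mul_of_ae_le hX.measurable (M := 0) (hc.mono fun a ha => by linarith)

lemma ae_eq_zero_of_ae_nonneg (hX : FormallySubGaussian X p) (hi : Integrable X p)
    (h : ∀ᵐ a ∂p, 0 ≤ X a) : ∀ᵐ a ∂p, X a = 0 :=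
  (integral_eq_zero_iff_of_nonneg_ae h hi).1 hX.integral_eq_zero

lemma ae_eq_zero_of_ae_nonpos (hX : FormallySubGaussian X p) (hi : Integrable X p)
    (h : ∀ᵐ a ∂p, X a ≤ 0) : ∀ᵐ a ∂p, X a = 0 :=
  (hX.neg.ae_eq_zero_of_ae_nonneg hi.neg (h.mono fun _ ha => neg_nonneg.2 ha)).mono
    fun _ ha => neg_eq_zero.1 ha

lemma ae_mul_nonpos_of_not_integrable [IsProbabilityMeasure p] [IsProbabilityMeasure q]
    (hX : FormallySubGaussian X p)
    (hY : FormallySubGaussian Y q) (hi : ¬ Integrable X p) {s : ℝ} (hs : 0 < s)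
    (hp : ∀ᵐ b ∂q, Integrable (fun a => exp (s * Y b * X a)) p)
    (hq : ∀ᵐ a ∂p, Integrable (fun b => exp (s * X a * Y b)) q) :
    ∀ᵐ z ∂(p.prod q), X z.1 * Y z.2 ≤ 0 := by
  have lift_fst {P : α → Prop} (h : ∀ᵐ a ∂p, P a) : ∀ᵐ z ∂(p.prod q), P z.1 :=
    Measure.quasiMeasurePreserving_fst.ae h
  have lift_snd {P : β → Prop} (h : ∀ᵐ b ∂q, P b) : ∀ᵐ z ∂(p.prod q), P z.2 :=
    Measure.quasiMeasurePreserving_snd.ae h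
  by_cases hiY : Integrable Y q
  · have h0 : ∀ᵐ b ∂q, Y b = 0 := by
      rcases hX.ae_nonpos_or_ae_nonneg_of_not_integrable hi hs hp with h | h
      · exact hY.ae_eq_zero_of_ae_nonpos hiY h.1
      · exact hY.ae_eq_zero_of_ae_nonneg hiY h.1
    filter_upwards [lift_snd h0] with z hz
    simp [hz]
  · rcases hX.ae_nonpos_or_ae_nonneg_of_not_integrable hi hs hp with h | h <;>
    rcases hY.ae_nonpos_or_ae_nonneg_of_not_integrable hiY hs hq with h' | h'
    · exact absurd h'.1 h.2
    · filter_upwards [lift_snd h.1, lift_fst h'.1] with z hy hx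
      exact mul_nonpos_of_nonneg_of_nonpos hx hy
    · filter_upwards [lift_snd h.1, lift_fst h'.1] with z hy hx
      exact mul_nonpos_of_nonpos_of_nonneg hx hy
    · exact absurd h'.1 h.2

lemma lintegral_sq_le_of_ae_integrable [IsProbabilityMeasure p]
    (hX : FormallySubGaussian X p) (hi : Integrable X p)
    {s : ℝ} (hs : 0 < s) (hY : ¬ ∀ᵐ b ∂q, Y b = 0)
    (hp : ∀ᵐ b ∂q, Integrable (fun a => exp (s * Y b * X a)) p) :
    ∫⁻ a, ENNReal.ofReal (X a ^ 2) ∂p ≤ 8 := by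
  by_contra hc
  refine hY (hp.mono fun b hb => ?_)
  by_contra hne
  exact hc (hX.lintegral_sq_le hi (mul_ne_zero hs.ne' hne) hb)

theorem integral_exp_mul_le [IsProbabilityMeasure p] [IsProbabilityMeasure q]
    (hX : FormallySubGaussian X p) (hY : FormallySubGaussian Y q)
    {s : ℝ} (hs : 0 < s) (hs' : s ≤ 1 / 4) :
    ∫ z, exp (s * (X z.1 * Y z.2)) ∂(p.prod q)
      ≤ exp (s ^ 2 * (32 * expSqBound.toReal + 32)) := by
  have hmX := hX.measurable
  have hmY := hY.measurable
  by_cases hint : Integrable (fun z : α × β => exp (s * (X z.1 * Y z.2))) (p.prod q)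
  swap
  · rw [integral_undef hint]; positivity
  have hp : ∀ᵐ b ∂q, Integrable (fun a => exp (s * Y b * X a)) p :=
    hint.prod_left_ae.mono fun b hb => by simpa only [mul_assoc, mul_comm (Y b)] using hb
  have hq : ∀ᵐ a ∂p, Integrable (fun b => exp (s * X a * Y b)) q :=
    hint.prod_right_ae.mono fun b hb => by simpa only [mul_assoc] using hb
  have hone : (1 : ℝ) ≤ exp (s ^ 2 * (32 * expSqBound.toReal + 32)) :=
    one_le_exp (by positivity)
  have of_nonpos (h : ∀ᵐ z ∂(p.prod q), X z.1 * Y z.2 ≤ 0) :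
      ∫ z, exp (s * (X z.1 * Y z.2)) ∂(p.prod q)
        ≤ exp (s ^ 2 * (32 * expSqBound.toReal + 32)) := by
    refine le_trans ?_ hone
    refine (integral_mono_ae hint (integrable_const (1 : ℝ)) (h.mono fun z hz =>
      exp_le_one_iff.2 (mul_nonpos_of_nonneg_of_nonpos hs.le hz))).trans_eq (by simp)
  by_cases hiX : Integrable X p
  swap
  · exact of_nonpos (hX.ae_mul_nonpos_of_not_integrable hY hiX hs hp hq)
  by_cases hiY : Integrable Y q
  swap
  · refine of_nonpos ?_
    have h := hY.ae_mul_nonpos_of_not_integrable hX hiY hs hq hp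
    refine (Measure.measurePreserving_swap.quasiMeasurePreserving.ae h).mono fun z hz => ?_
    simpa [mul_comm] using hz
  by_cases hX0 : ∀ᵐ a ∂p, X a = 0
  · exact of_nonpos ((Measure.quasiMeasurePreserving_fst.ae hX0).mono fun z hz => by simp [hz])
  by_cases hY0 : ∀ᵐ b ∂q, Y b = 0
  · exact of_nonpos ((Measure.quasiMeasurePreserving_snd.ae hY0).mono fun z hz => by simp [hz])
  have hpos := hX.lintegral_expRemainder_posPart_mul_posPart_le hY hiX hiY hs hs' hp hq
  have hneg := hX.neg.lintegral_expRemainder_posPart_mul_posPart_le hY.neg hiX.neg hiY.neg hs hs'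
    (by simpa using hp) (by simpa using hq)
  have hX2 := hX.lintegral_sq_le_of_ae_integrable hiX hs hY0 hp
  have hY2 := hY.lintegral_sq_le_of_ae_integrable hiY hs hX0 hq
  have h1 : Integrable (fun z : α × β => exp (s * (X z.1 * Y z.2)) - 1) (p.prod q) :=
    hint.sub (integrable_const 1)
  have h2 : Integrable (fun z : α × β => s * (X z.1 * Y z.2)) (p.prod q) :=
    (hiX.mul_prod hiY).const_mul s
  have h3 : Integrable (fun z : α × β => expRemainder (s * (X z.1 * Y z.2))) (p.prod q) :=
    h1.sub h2
  have heq : ∫ z, expRemainder (s * (X z.1 * Y z.2)) ∂(p.prod q)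
      = ∫ z, exp (s * (X z.1 * Y z.2)) ∂(p.prod q) - 1 := by
    unfold expRemainder
    rw [integral_sub h1 h2, integral_sub hint (integrable_const 1), integral_const_mul,
      integral_prod_mul, hX.integral_eq_zero]
    simp
  have hbound : ENNReal.ofReal (∫ z, expRemainder (s * (X z.1 * Y z.2)) ∂(p.prod q))
      ≤ ENNReal.ofReal (s ^ 2 * (32 * expSqBound.toReal + 32)) := by
    rw [ofReal_integral_eq_lintegral_ofReal h3 (ae_of_all _ fun a => expRemainder_nonneg _)]
    have hm1 : Measurable fun z : α × β =>
        ENNReal.ofReal (expRemainder (s * (max (X z.1) 0 * max (Y z.2) 0))) :=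
      (measurable_expRemainder.comp (by fun_prop)).ennreal_ofReal
    have hm2 : Measurable fun z : α × β =>
        ENNReal.ofReal (expRemainder (s * (max (-X z.1) 0 * max (-Y z.2) 0))) :=
      (measurable_expRemainder.comp (by fun_prop)).ennreal_ofReal
    calc ∫⁻ z, ENNReal.ofReal (expRemainder (s * (X z.1 * Y z.2))) ∂(p.prod q)
        ≤ ∫⁻ z, (ENNReal.ofReal (expRemainder (s * (max (X z.1) 0 * max (Y z.2) 0)))
          + ENNReal.ofReal (expRemainder (s * (max (-X z.1) 0 * max (-Y z.2) 0)))
          + ENNReal.ofReal (s ^ 2 / 2) *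
            (ENNReal.ofReal (X z.1 ^ 2) * ENNReal.ofReal (Y z.2 ^ 2))) ∂(p.prod q) := by
          refine lintegral_mono fun z => ?_
          rw [← ENNReal.ofReal_mul (by positivity), ← ENNReal.ofReal_mul (by positivity),
            ← ENNReal.ofReal_add (expRemainder_nonneg _) (expRemainder_nonneg _),
            ← ENNReal.ofReal_add (add_nonneg (expRemainder_nonneg _) (expRemainder_nonneg _))
              (by positivity)]
          exact ENNReal.ofReal_le_ofReal (expRemainder_mul_le s _ _ hs)
      _ ≤ ENNReal.ofReal (16 * s ^ 2) * expSqBound + ENNReal.ofReal (16 * s ^ 2) * expSqBound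
          + ENNReal.ofReal (s ^ 2 / 2) * (8 * 8) := by
          rw [lintegral_add_right _ (by fun_prop), lintegral_add_left hm1,
            lintegral_const_mul _ (by fun_prop),
            lintegral_prod_mul (f := fun a => ENNReal.ofReal (X a ^ 2))
              (g := fun b => ENNReal.ofReal (Y b ^ 2)) (by fun_prop) (by fun_prop)]
          gcongr
      _ = ENNReal.ofReal (s ^ 2 * (32 * expSqBound.toReal + 32)) := by
          rw [← ENNReal.ofReal_toReal expSqBound_ne_top,
            show (8 : ℝ≥0∞) = ENNReal.ofReal 8 by norm_num,
            ← ENNReal.ofReal_mul (by positivity), ← ENNReal.ofReal_mul (by positivity),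
            ← ENNReal.ofReal_mul (by positivity), ← ENNReal.ofReal_add (by positivity)
              (by positivity), ← ENNReal.ofReal_add (by positivity) (by positivity),
            ENNReal.toReal_ofReal ENNReal.toReal_nonneg]
          congr 1; ring
  have h4 := (ENNReal.ofReal_le_ofReal_iff (by positivity)).1 hbound
  linarith [add_one_le_exp (s ^ 2 * (32 * expSqBound.toReal + 32))]

end FormallySubGaussian

lemma FormallySubGaussian.map_mul {Ω : Type*} [MeasurableSpace Ω] {μ : Measure Ω} {X : Ω → ℝ}
    {σ c : ℝ} (hm : Measurable X) (h0 : ∫ ω, X ω ∂μ = 0)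
    (h : ∀ t : ℝ, ∫ ω, exp (t * X ω) ∂μ ≤ exp (t ^ 2 * σ ^ 2)) (hc : c ^ 2 * σ ^ 2 = 1) :
    FormallySubGaussian (fun x : ℝ => c * x) (μ.map X) where
  measurable := by fun_prop
  integral_eq_zero := by
    rw [integral_const_mul, integral_map hm.aemeasurable (by fun_prop), h0, mul_zero]
  integral_exp_le t := by
    rw [integral_map hm.aemeasurable (by fun_prop)]
    calc ∫ ω, exp (t * (c * X ω)) ∂μ = ∫ ω, exp (t * c * X ω) ∂μ := by simp only [mul_assoc]
      _ ≤ exp ((t * c) ^ 2 * σ ^ 2) := h _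
      _ = exp (t ^ 2) := by rw [mul_pow, mul_assoc, hc, mul_one]

/-- There are absolute constants `C₁, C₂ > 0` such that for all
independent zero-mean sub-Gaussian `X, Y` with parameters `σ_X, σ_Y`, the product `XY`
satisfies `E[exp(t·XY)] ≤ exp(t²(C₁σ_Xσ_Y)²)` for all `|t| ≤ C₂/(σ_Xσ_Y)`. -/
theorem product_of_independent_subGaussians_is_subExponential :
    ∃ C₁ C₂ : ℝ, 0 < C₁ ∧ 0 < C₂ ∧
      ∀ (Ω : Type) (mΩ : MeasurableSpace Ω) (μ : Measure Ω),
        IsProbabilityMeasure μ →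
        ∀ (X Y : Ω → ℝ) (σX σY : ℝ), 0 < σX → 0 < σY →
          Measurable X → Measurable Y →
          IndepFun X Y μ →
          (∫ ω, X ω ∂μ) = 0 → (∫ ω, Y ω ∂μ) = 0 →
          (∀ t : ℝ, ∫ ω, exp (t * X ω) ∂μ ≤ exp (t ^ 2 * σX ^ 2)) →
          (∀ t : ℝ, ∫ ω, exp (t * Y ω) ∂μ ≤ exp (t ^ 2 * σY ^ 2)) →
          ∀ t : ℝ, |t| ≤ C₂ / (σX * σY) →
            ∫ ω, exp (t * (X ω * Y ω)) ∂μ ≤ exp (t ^ 2 * (C₁ * σX * σY) ^ 2) := by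
  refine ⟨√(32 * expSqBound.toReal + 32), 1 / 4, by positivity, by norm_num, ?_⟩
  intro Ω _ μ _ X Y σX σY hσX hσY hmX hmY hind hX0 hY0 hX hY t ht
  have hσ : 0 < σX * σY := mul_pos hσX hσY
  rcases eq_or_ne t 0 with rfl | ht0
  · simp
  have hpX : IsProbabilityMeasure (μ.map X) := Measure.isProbabilityMeasure_map hmX.aemeasurable
  have hpY : IsProbabilityMeasure (μ.map Y) := Measure.isProbabilityMeasure_map hmY.aemeasurable
  have habs : |t| ≠ 0 := abs_ne_zero.2 ht0
  have hX' := FormallySubGaussian.map_mul (c := t / |t| / σX) hmX hX0 hX (by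
    rw [div_pow, div_pow, sq_abs]; field_simp)
  have hY' := FormallySubGaussian.map_mul (c := σY⁻¹) hmY hY0 hY (by field_simp)
  have key := hX'.integral_exp_mul_le hY' (s := |t| * (σX * σY)) (by positivity)
    (by rwa [le_div_iff₀ hσ] at ht)
  rw [← (indepFun_iff_map_prod_eq_prod_map_map hmX.aemeasurable hmY.aemeasurable).1 hind,
    integral_map (hmX.prodMk hmY).aemeasurable (by fun_prop)] at key
  calc ∫ ω, exp (t * (X ω * Y ω)) ∂μ
      = ∫ ω, exp (|t| * (σX * σY) * (t / |t| / σX * X ω * (σY⁻¹ * Y ω))) ∂μ := by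
        congr with ω
        field_simp
    _ ≤ _ := key
    _ = _ := by
        simp only [mul_pow]
        rw [sq_sqrt (by positivity), sq_abs]
        ring_nf
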